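/- Let d ≥ k ≥ 2 and n ≥ 1, and let (x_1, y_1), …, (x_n, y_n) be i.i.d. samples from the target distribution D_t. Then the probability of the event that either there exists j ∈ {2, …, k} with x_{i[j]}^2 = x_{i[1]}^2 for all i ∈ {1,…,n}, or x_{i[1]} = 0 for all i ∈ {1,…,n}, is at most k·(2/3)^n. (In particular, for each fixed j ∈ {2,…,k}, the per-sample probability that x_{[j]}^2 = x_{[1]}^2 equals 5/9, and the per-sample probability that x_{[1]} = 0 equals 1/3.) -/

import Mathlib

open MeasureTheory Finset

noncomputable section

/-- Uniform measure on `{-1, 0, 1} ⊆ ℝ`. -/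
def unif3 : Measure ℝ :=
  (PMF.uniformOfFinset ({-1, 0, 1} : Finset ℝ) (by norm_num)).toMeasure

/-- Uniform measure on `{-1, 1} ⊆ ℝ`. -/
def unif2 : Measure ℝ :=
  (PMF.uniformOfFinset ({-1, 1} : Finset ℝ) (by norm_num)).toMeasure

/-- Distribution of `x` conditioned on `y = 0` under the source distribution `D_s^(k)`. -/
def srcBranch0 (d k : ℕ) : Measure (Fin d → ℝ) :=
  Measure.pi (fun i => if (i : ℕ) < k then Measure.dirac (0 : ℝ) else unif3)

/-- Distribution of `x` conditioned on `y = 1` under the source distribution `D_s^(k)`. -/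
def srcBranch1 (d k : ℕ) : Measure (Fin d → ℝ) :=
  Measure.pi (fun i => if (i : ℕ) < k then unif2 else unif3)

/-- The source distribution `D_s^(k)` on `ℝ^d × ℝ`. -/
def sourceMeasure (d k : ℕ) : Measure ((Fin d → ℝ) × ℝ) :=
  (1/3 : ENNReal) • (srcBranch0 d k).map (fun x => (x, (0 : ℝ)))
    + (2/3 : ENNReal) • (srcBranch1 d k).map (fun x => (x, (1 : ℝ)))

/-- The target distribution `D_t = D_s^(1)`. -/
def targetMeasure (d : ℕ) : Measure ((Fin d → ℝ) × ℝ) := sourceMeasure d 1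

/-- The two-layer quadratic network `f_{θ,φ}(x) = ∑ i, θ i (w_i ⬝ x)^2`,
where `w_i` is the `i`-th column of `φ`. -/
def qnet {d m : ℕ} (θ : Fin m → ℝ) (φ : Matrix (Fin d) (Fin m) ℝ) (x : Fin d → ℝ) : ℝ :=
  ∑ i, θ i * (∑ j, φ j i * x j) ^ 2

/-- Population squared loss on the distribution `D`. -/
def popLoss {d m : ℕ} (D : Measure ((Fin d → ℝ) × ℝ)) (θ : Fin m → ℝ)
    (φ : Matrix (Fin d) (Fin m) ℝ) : ℝ :=
  ∫ p, (qnet θ φ p.1 - p.2) ^ 2 ∂D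

/-- Empirical squared loss on the dataset `S`. -/
def empLoss {d m n : ℕ} (S : Fin n → (Fin d → ℝ) × ℝ) (θ : Fin m → ℝ)
    (φ : Matrix (Fin d) (Fin m) ℝ) : ℝ :=
  (1 / (n : ℝ)) * ∑ i, (qnet θ φ (S i).1 - (S i).2) ^ 2

/-- Squared Frobenius norm of the feature extractor. -/
def frobSq {d m : ℕ} (φ : Matrix (Fin d) (Fin m) ℝ) : ℝ := ∑ j, ∑ i, (φ j i) ^ 2

/-- Squared Euclidean norm of a head. -/
def normSq {m : ℕ} (θ : Fin m → ℝ) : ℝ := ∑ i, (θ i) ^ 2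

/-- The regularized joint training objective `L_joint^λ`. -/
def jointObj {d m n : ℕ} (k : ℕ) (α lam : ℝ) (S : Fin n → (Fin d → ℝ) × ℝ)
    (θs θt : Fin m → ℝ) (φ : Matrix (Fin d) (Fin m) ℝ) : ℝ :=
  (1 - α) * popLoss (sourceMeasure d k) θs φ + α * empLoss S θt φ
    + lam * (normSq θs + normSq θt + frobSq φ)

end

instance unif3_prob : IsProbabilityMeasure unif3 := by unfold unif3; infer_instance

instance unif2_prob : IsProbabilityMeasure unif2 := by unfold unif2; infer_instance

instance ite0_prob (P : Prop) [Decidable P] :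
    IsProbabilityMeasure (if P then Measure.dirac (0 : ℝ) else unif3) := by
  split_ifs <;> infer_instance

instance ite1_prob (P : Prop) [Decidable P] :
    IsProbabilityMeasure (if P then unif2 else unif3) := by
  split_ifs <;> infer_instance

instance srcBranch0_prob (d k : ℕ) : IsProbabilityMeasure (srcBranch0 d k) := by
  unfold srcBranch0; infer_instance

instance srcBranch1_prob (d k : ℕ) : IsProbabilityMeasure (srcBranch1 d k) := by
  unfold srcBranch1; infer_instance

lemma third_ne_top : (1/3 : ENNReal) ≠ ⊤ := ENNReal.div_ne_top (by simp) (by simp)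
lemma twothird_ne_top : (2/3 : ENNReal) ≠ ⊤ := ENNReal.div_ne_top (by simp) (by simp)

instance target_fin (d : ℕ) : IsFiniteMeasure (targetMeasure d) := by
  unfold targetMeasure sourceMeasure
  have := Measure.smul_finite ((srcBranch0 d 1).map (fun x => (x, (0 : ℝ)))) third_ne_top
  have := Measure.smul_finite ((srcBranch1 d 1).map (fun x => (x, (1 : ℝ)))) twothird_ne_top
  infer_instance

lemma target_apply (d : ℕ) (A : Set (Fin d → ℝ)) (hA : MeasurableSet A) :
    targetMeasure d {p | p.1 ∈ A} = 1/3 * srcBranch0 d 1 A + 2/3 * srcBranch1 d 1 A := by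
  unfold targetMeasure sourceMeasure
  have hm : MeasurableSet {p : (Fin d → ℝ) × ℝ | p.1 ∈ A} := measurable_fst hA
  rw [Measure.add_apply, Measure.smul_apply, Measure.smul_apply,
    Measure.map_apply (by fun_prop) hm, Measure.map_apply (by fun_prop) hm]
  rfl

lemma pi_eval_apply {d : ℕ} (μ : Fin d → Measure ℝ) [∀ i, IsProbabilityMeasure (μ i)]
    (j : Fin d) (B : Set ℝ) (hB : MeasurableSet B) :
    Measure.pi μ {x | x j ∈ B} = μ j B :=
  (measurePreserving_eval μ j).measure_preimage hB.nullMeasurableSet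

lemma pi_sq {d : ℕ} (μ : Fin d → Measure ℝ) [∀ i, IsProbabilityMeasure (μ i)]
    (j z : Fin d) (c : ℝ) (h : ∀ᵐ x ∂(μ z), x ^ 2 = c) :
    Measure.pi μ {x | x j ^ 2 = x z ^ 2} = μ j {x | x ^ 2 = c} := by
  rw [← pi_eval_apply μ j _ (measurableSet_eq_fun (by fun_prop) (by fun_prop))]
  apply measure_congr
  have := (measurePreserving_eval μ z).quasiMeasurePreserving.ae h
  filter_upwards [this] with x hx
  apply propext
  show x j ^ 2 = x z ^ 2 ↔ x j ^ 2 = c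
  simp only [Function.eval] at hx
  rw [hx]

lemma msq (c : ℝ) : MeasurableSet {x : ℝ | x ^ 2 = c} :=
  measurableSet_eq_fun (by fun_prop) (by fun_prop)

lemma card3 : Finset.card ({-1, 0, 1} : Finset ℝ) = 3 := by
  rw [Finset.card_eq_three]; exact ⟨-1, 0, 1, by norm_num, by norm_num, by norm_num, rfl⟩

lemma unif3_zero : unif3 {x | x ^ 2 = 0} = 1/3 := by
  classical
  unfold unif3
  rw [PMF.toMeasure_uniformOfFinset_apply _ _ (msq 0), card3]
  have : (Finset.filter (· ∈ {x : ℝ | x ^ 2 = 0}) ({-1, 0, 1} : Finset ℝ)) = {0} := by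
    ext x; simp only [Finset.mem_filter, Finset.mem_insert, Finset.mem_singleton,
      Set.mem_ofPred_eq]
    constructor
    · rintro ⟨rfl | rfl | rfl, h⟩ <;> norm_num at *
    · rintro rfl; norm_num
  rw [this]; simp

lemma unif3_one : unif3 {x | x ^ 2 = 1} = 2/3 := by
  classical
  unfold unif3
  rw [PMF.toMeasure_uniformOfFinset_apply _ _ (msq 1), card3]
  have : (Finset.filter (· ∈ {x : ℝ | x ^ 2 = 1}) ({-1, 0, 1} : Finset ℝ)) = {-1, 1} := by
    ext x; simp only [Finset.mem_filter, Finset.mem_insert, Finset.mem_singleton,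
      Set.mem_ofPred_eq]
    constructor
    · rintro ⟨rfl | rfl | rfl, h⟩ <;> norm_num at *
    · rintro (rfl | rfl) <;> norm_num
  rw [this, Finset.card_pair (by norm_num)]; simp

lemma unif2_null (t : Set ℝ) (ht : MeasurableSet t)
    (h : ∀ x ∈ ({-1, 1} : Finset ℝ), x ∉ t) : unif2 t = 0 := by
  classical
  unfold unif2
  rw [PMF.toMeasure_uniformOfFinset_apply _ _ ht, Finset.filter_false_of_mem h]
  simp

lemma unif2_ae : ∀ᵐ x ∂unif2, x ^ 2 = 1 := by
  rw [ae_iff]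
  refine unif2_null _ (msq 1).compl ?_
  intro x hx
  simp only [Finset.mem_insert, Finset.mem_singleton] at hx
  rcases hx with rfl | rfl <;> simp

lemma target_sq (d : ℕ) (j z : Fin d) (hz : (z : ℕ) = 0) (hj : 1 ≤ (j : ℕ)) :
    targetMeasure d {p | p.1 j ^ 2 = p.1 z ^ 2} = ENNReal.ofReal (5 / 9) := by
  have h := target_apply d {x | x j ^ 2 = x z ^ 2}
    (measurableSet_eq_fun (by fun_prop) (by fun_prop))
  simp only [Set.mem_ofPred_eq] at h
  rw [h]
  unfold srcBranch0 srcBranch1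
  rw [pi_sq _ j z 0 (by simp [hz]), pi_sq _ j z 1 (by simpa [hz] using unif2_ae)]
  rw [if_neg (by omega), if_neg (by omega), unif3_zero, unif3_one]
  rw [← ENNReal.toReal_eq_toReal_iff' (by finiteness) (by finiteness)]
  rw [ENNReal.toReal_add (by finiteness) (by finiteness)]
  simp
  norm_num

lemma target_zero (d : ℕ) (z : Fin d) (hz : (z : ℕ) = 0) :
    targetMeasure d {p | p.1 z = 0} = ENNReal.ofReal (1 / 3) := by
  have h := target_apply d {x | x z ∈ ({0} : Set ℝ)}
    (measurable_pi_apply z (measurableSet_singleton 0))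
  simp only [Set.mem_ofPred_eq, Set.mem_singleton_iff] at h
  rw [h]
  have e0 : srcBranch0 d 1 {x | x z = 0} = 1 := by
    have := pi_eval_apply (fun i : Fin d => if (i : ℕ) < 1 then Measure.dirac (0 : ℝ) else unif3)
      z {0} (measurableSet_singleton 0)
    simpa [srcBranch0, hz] using this
  have e1 : srcBranch1 d 1 {x | x z = 0} = 0 := by
    have := pi_eval_apply (fun i : Fin d => if (i : ℕ) < 1 then unif2 else unif3)
      z {0} (measurableSet_singleton 0)
    have h0 : unif2 {0} = 0 := by
      refine measure_mono_null ?_ (ae_iff.1 unif2_ae)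
      rintro x rfl; simp
    simpa [srcBranch1, hz, h0] using this
  rw [e0, e1, ENNReal.ofReal_div_of_pos (by norm_num)]
  simp

lemma pi_all_le (d n : ℕ) (A : Set ((Fin d → ℝ) × ℝ))
    (hA : targetMeasure d A ≤ ENNReal.ofReal (2/3)) :
    Measure.pi (fun _ : Fin n => targetMeasure d) {S | ∀ i, S i ∈ A}
      ≤ ENNReal.ofReal ((2/3) ^ n) := by
  have : {S : Fin n → (Fin d → ℝ) × ℝ | ∀ i, S i ∈ A} = Set.pi Set.univ (fun _ => A) := by
    ext; simp
  rw [this, Measure.pi_pi, Finset.prod_const, Finset.card_univ, Fintype.card_fin,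
    ENNReal.ofReal_pow (by norm_num)]
  gcongr

open MeasureTheory in
/-- Union bound over source-specific features: for `n` i.i.d. target samples, the probability
that some coordinate `j ∈ {2, …, k}` satisfies `x_{[j]}² = x_{[1]}²` on every sample, or that
`x_{[1]} = 0` on every sample, is at most `k (2/3)^n`. In particular, per sample,
`P(x_{[j]}² = x_{[1]}²) = 5/9` and `P(x_{[1]} = 0) = 1/3`.
(0-based coordinates: Fin index `0` is the paper's coordinate `1`, and `1 ≤ (j : ℕ) < k`
corresponds to the paper's `j ∈ {2, …, k}`.) -/
theorem bad_feature_probability (d k n : ℕ) (h2 : 2 ≤ k) (hkd : k ≤ d) (hn : 1 ≤ n) :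
    (Measure.pi (fun _ : Fin n => targetMeasure d))
        {S : Fin n → (Fin d → ℝ) × ℝ |
          (∃ j : Fin d, 1 ≤ (j : ℕ) ∧ (j : ℕ) < k ∧
              ∀ i : Fin n, ((S i).1 j) ^ 2 = ((S i).1 ⟨0, by omega⟩) ^ 2)
            ∨ ∀ i : Fin n, (S i).1 ⟨0, by omega⟩ = 0}
        ≤ ENNReal.ofReal ((k : ℝ) * (2 / 3) ^ n)
      ∧ (∀ j : Fin d, 1 ≤ (j : ℕ) → (j : ℕ) < k →
          targetMeasure d {p : (Fin d → ℝ) × ℝ | (p.1 j) ^ 2 = (p.1 ⟨0, by omega⟩) ^ 2}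
            = ENNReal.ofReal (5 / 9))
      ∧ targetMeasure d {p : (Fin d → ℝ) × ℝ | p.1 ⟨0, by omega⟩ = 0}
          = ENNReal.ofReal (1 / 3) := by
  refine ⟨?_, fun j hj _ => target_sq d j _ rfl hj, target_zero d _ rfl⟩
  have hd : 0 < d := by omega
  let E : ℕ → Set ((Fin d → ℝ) × ℝ) := fun m =>
    if h : 1 ≤ m ∧ m < d then {p | p.1 ⟨m, h.2⟩ ^ 2 = p.1 ⟨0, hd⟩ ^ 2}
    else {p | p.1 ⟨0, hd⟩ = 0}
  have hE : ∀ m, targetMeasure d (E m) ≤ ENNReal.ofReal (2/3) := by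
    intro m
    by_cases h : 1 ≤ m ∧ m < d
    · simp only [E, dif_pos h]
      rw [target_sq d ⟨m, h.2⟩ ⟨0, hd⟩ rfl h.1]
      exact ENNReal.ofReal_le_ofReal (by norm_num)
    · simp only [E, dif_neg h]
      rw [target_zero d ⟨0, hd⟩ rfl]
      exact ENNReal.ofReal_le_ofReal (by norm_num)
  calc _ ≤ Measure.pi (fun _ : Fin n => targetMeasure d)
        (⋃ m ∈ Finset.range k, {S | ∀ i, S i ∈ E m}) := by
        apply measure_mono
        rintro S (⟨j, hj, hjk, h⟩ | h)
        · simp only [Set.mem_iUnion]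
          refine ⟨j, Finset.mem_range.2 hjk, fun i => ?_⟩
          simp only [E, dif_pos (show 1 ≤ (j : ℕ) ∧ (j : ℕ) < d from ⟨hj, j.2⟩)]
          exact h i
        · simp only [Set.mem_iUnion]
          refine ⟨0, Finset.mem_range.2 (by omega), fun i => ?_⟩
          simp only [E, dif_neg (show ¬ (1 ≤ 0 ∧ 0 < d) by omega)]
          exact h i
    _ ≤ ∑ m ∈ Finset.range k, Measure.pi (fun _ : Fin n => targetMeasure d)
          {S | ∀ i, S i ∈ E m} := measure_biUnion_finset_le _ _
    _ ≤ ∑ m ∈ Finset.range k, ENNReal.ofReal ((2/3) ^ n) :=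
        Finset.sum_le_sum fun m _ => pi_all_le d n _ (hE m)
    _ = _ := by
        rw [Finset.sum_const, Finset.card_range, nsmul_eq_mul,
          ENNReal.ofReal_mul (by positivity), ENNReal.ofReal_natCast]
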